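/- Let x = (α,β,A,B) ∈ M_ℤ be of rank 2, i.e. T(x,x,x) = 0 but the rank ≤ 1 conditions fail (it is not the case that αA − B# = 0, βB − A# = 0, and (αβ − (A,B))C + ABC + CBA = 0 for all C ∈ J_ℤ). Then there exist g ∈ G_ℤ and positive integers k, m with k ∣ m such that g(x) = (k, 0, diag(m,0,0), 0), where k is the gcd of the 20 integer coordinates of x. Moreover, for positive integers k, m, k', m' with k ∣ m and k' ∣ m', if some g ∈ G_ℤ maps (k, 0, diag(m,0,0), 0) to (k', 0, diag(m',0,0), 0), then k = k' and m = m'. -/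

import Mathlib

open Matrix

namespace FreudenthalZ

/-- The integral cubic Jordan algebra `J_ℤ = M₃(ℤ)`. -/
abbrev MatZ := Matrix (Fin 3) (Fin 3) ℤ

/-- The trace bilinear form `(A, B) = tr(A·B)`. -/
def tb (A B : MatZ) : ℤ := (A * B).trace

/-- The Freudenthal cross product `A × B = (A+B)# − A# − B#` (adjoint = adjugate). -/
def cross (A B : MatZ) : MatZ := (A + B).adjugate - A.adjugate - B.adjugate

/-- The integral Freudenthal module `M_ℤ = ℤ ⊕ ℤ ⊕ J_ℤ ⊕ J_ℤ`, elements `(α, β, A, B)`. -/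
abbrev MZ := ℤ × ℤ × MatZ × MatZ

/-- The quartic norm `q'(x) = ((A,B) − αβ)² − 4(A#,B#) + 4α·det A + 4β·det B`. -/
def qz (x : MZ) : ℤ :=
  (tb x.2.2.1 x.2.2.2 - x.1 * x.2.1) ^ 2 - 4 * tb x.2.2.1.adjugate x.2.2.2.adjugate
    + 4 * x.1 * x.2.2.1.det + 4 * x.2.1 * x.2.2.2.det

/-- The symplectic form `{x, y} = αδ − βγ + (A,D) − (B,C)`. -/
def symp (x y : MZ) : ℤ :=
  x.1 * y.2.1 - x.2.1 * y.1 + tb x.2.2.1 y.2.2.2 - tb x.2.2.2 y.2.2.1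

/-- Membership in the group `G_ℤ`: `ℤ`-linear automorphisms of `M_ℤ`
preserving the quartic norm `q'` and the symplectic form `{·,·}`. -/
def InG (g : MZ → MZ) : Prop :=
  IsLinearMap ℤ g ∧ Function.Bijective g ∧
    (∀ x, qz (g x) = qz x) ∧ (∀ x y, symp (g x) (g y) = symp x y)

/-- `x` is projective: some `g ∈ G_ℤ` maps `x` to a diagonal reduced element
`(α, β, diag(a₁,a₂,a₃), 0)` (`α > 0`, `α ∣ β`, `α ∣ aᵢ`) satisfying the three gcd
conditions `gcd(α·aᵢ, α·β, aⱼ·a_k) = 1`. -/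
def Projective (x : MZ) : Prop :=
  ∃ g : MZ → MZ, InG g ∧ ∃ α β a₁ a₂ a₃ : ℤ,
    g x = (α, β, Matrix.diagonal ![a₁, a₂, a₃], 0) ∧
    0 < α ∧ α ∣ β ∧ α ∣ a₁ ∧ α ∣ a₂ ∧ α ∣ a₃ ∧
    Int.gcd (Int.gcd (α * a₁) (α * β)) (a₂ * a₃) = 1 ∧
    Int.gcd (Int.gcd (α * a₂) (α * β)) (a₃ * a₁) = 1 ∧
    Int.gcd (Int.gcd (α * a₃) (α * β)) (a₁ * a₂) = 1

end FreudenthalZ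

open FreudenthalZ

namespace FreudenthalZ

/-- The trilinear cube `T(x,x,x)`. -/
def Tcube (x : MZ) : MZ :=
  (-(x.1 ^ 2 * x.2.1) + x.1 * tb x.2.2.1 x.2.2.2 - 2 * x.2.2.2.det,
   x.1 * x.2.1 ^ 2 - x.2.1 * tb x.2.2.1 x.2.2.2 + 2 * x.2.2.1.det,
   (2 : ℤ) • cross x.2.2.2 x.2.2.1.adjugate - (2 * x.2.1) • x.2.2.2.adjugate
     - (tb x.2.2.1 x.2.2.2 - x.1 * x.2.1) • x.2.2.1,
   -((2 : ℤ) • cross x.2.2.1 x.2.2.2.adjugate) + (2 * x.1) • x.2.2.1.adjugate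
     + (tb x.2.2.1 x.2.2.2 - x.1 * x.2.1) • x.2.2.2)

/-- The rank `≤ 1` condition: `αA − B# = 0`, `βB − A# = 0`, and
`(αβ − (A,B))C + ABC + CBA = 0` for all `C ∈ J_ℤ`. -/
def RankLeOne (x : MZ) : Prop :=
  x.1 • x.2.2.1 - x.2.2.2.adjugate = 0 ∧
  x.2.1 • x.2.2.2 - x.2.2.1.adjugate = 0 ∧
  ∀ C : MatZ,
    (x.1 * x.2.1 - tb x.2.2.1 x.2.2.2) • C
      + x.2.2.1 * x.2.2.2 * C + C * x.2.2.2 * x.2.2.1 = 0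

/-- The gcd of the 20 integer coordinates of `x = (α, β, A, B)` (the entries `α`, `β`
and the matrix entries of `A` and `B`), as a nonnegative integer. -/
def gcd20 (x : MZ) : ℤ :=
  gcd x.1 (gcd x.2.1
    (gcd (Finset.univ.gcd fun p : Fin 3 × Fin 3 => x.2.2.1 p.1 p.2)
         (Finset.univ.gcd fun p : Fin 3 × Fin 3 => x.2.2.2 p.1 p.2)))

end FreudenthalZ

namespace FreudenthalZ

def phi (t : ℤ) (x : MZ) : MZ :=
  (x.1 + t * x.2.2.2 0 0, x.2.1,
   !![x.2.2.1 0 0 + t * x.2.1, x.2.2.1 0 1, x.2.2.1 0 2;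
      x.2.2.1 1 0, x.2.2.1 1 1, x.2.2.1 1 2;
      x.2.2.1 2 0, x.2.2.1 2 1, x.2.2.1 2 2],
   !![x.2.2.2 0 0, x.2.2.2 0 1, x.2.2.2 0 2;
      x.2.2.2 1 0, x.2.2.2 1 1 + t * x.2.2.1 2 2, x.2.2.2 1 2 - t * x.2.2.1 1 2;
      x.2.2.2 2 0, x.2.2.2 2 1 - t * x.2.2.1 2 1, x.2.2.2 2 2 + t * x.2.2.1 1 1])

def sw (x : MZ) : MZ := (-x.2.1, x.1, -x.2.2.2, x.2.2.1)

def lev (P Q : MatZ) (x : MZ) : MZ :=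
  (x.1, x.2.1, P * x.2.2.1 * Q, Q.adjugate * x.2.2.2 * P.adjugate)

theorem rank_aux (p : ℤ) (M N : MatZ) (hMN : M.trace = N.trace)
    (h : ∀ C : MatZ, (p - M.trace) • C + M * C + C * N = 0) : M = p • 1 ∧ N = p • 1 := by
  have key : ∀ i j k l : Fin 3, ((p - M.trace) • (single i j (1:ℤ) : MatZ) + M * single i j 1
        + single i j 1 * N : MatZ) k l = 0 := by
    intro i j k l; rw [h]; rfl
  rw [trace_fin_three, trace_fin_three] at hMN
  simp [Fin.forall_fin_succ, -zsmul_eq_mul, trace_fin_three, mul_apply, Fin.sum_univ_three, single_apply] at key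
  constructor
  · ext i j
    fin_cases i <;> fin_cases j <;> simp [-zsmul_eq_mul] <;> omega
  · ext i j
    fin_cases i <;> fin_cases j <;> simp [-zsmul_eq_mul] <;> omega

theorem rank_iff (x : MZ) : RankLeOne x ↔
    x.1 • x.2.2.1 = x.2.2.2.adjugate ∧ x.2.1 • x.2.2.2 = x.2.2.1.adjugate ∧
    x.2.2.1 * x.2.2.2 = (x.1 * x.2.1) • 1 ∧ x.2.2.2 * x.2.2.1 = (x.1 * x.2.1) • 1 := by
  obtain ⟨a, b, A, B⟩ := x
  simp only [RankLeOne, sub_eq_zero]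
  refine and_congr_right fun h1 => and_congr_right fun h2 => ?_
  constructor
  · intro h
    refine rank_aux (a * b) (A * B) (B * A) (trace_mul_comm _ _) fun C => ?_
    rw [← mul_assoc]
    exact h C
  · rintro ⟨h3, h4⟩ C
    have ht : tb A B = 3 * (a * b) := by
      rw [tb, h3, trace_smul, trace_one]; simp; ring
    rw [mul_assoc C, h3, h4, ht, smul_mul_assoc, mul_smul_comm, one_mul, mul_one]
    module

theorem phi_inv (t : ℤ) (x : MZ) : phi t (phi (-t) x) = x := by
  obtain ⟨a, b, A, B⟩ := x
  simp only [phi, Prod.mk.injEq]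
  refine ⟨by simp, trivial, ?_, ?_⟩ <;> ext i j <;> fin_cases i <;> fin_cases j <;> simp

theorem phi_lin (t : ℤ) : IsLinearMap ℤ (phi t) := by
  constructor
  · rintro ⟨a, b, A, B⟩ ⟨a', b', A', B'⟩
    simp only [phi, Prod.mk_add_mk, Prod.mk.injEq]
    refine ⟨by simp; ring, trivial, ?_, ?_⟩ <;> ext i j <;> fin_cases i <;> fin_cases j <;> simp <;> ring
  · rintro c ⟨a, b, A, B⟩
    simp only [phi, Prod.smul_mk, Prod.mk.injEq]
    refine ⟨by simp; ring, trivial, ?_, ?_⟩ <;> ext i j <;> fin_cases i <;> fin_cases j <;> simp <;> ring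

theorem phi_q (t : ℤ) (x : MZ) : qz (phi t x) = qz x := by
  obtain ⟨a, b, A, B⟩ := x
  simp [phi, qz, tb, trace_fin_three, mul_apply, Fin.sum_univ_three, adjugate_fin_three,
    det_fin_three]
  ring

theorem phi_symp (t : ℤ) (x y : MZ) : symp (phi t x) (phi t y) = symp x y := by
  obtain ⟨a, b, A, B⟩ := x
  obtain ⟨a', b', A', B'⟩ := y
  simp [phi, symp, tb, trace_fin_three, mul_apply, Fin.sum_univ_three]
  ring

set_option maxHeartbeats 4000000 in
theorem phi_T (t : ℤ) (x : MZ) : Tcube (phi t x) = phi t (Tcube x) := by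
  obtain ⟨a, b, A, B⟩ := x
  simp only [phi, Tcube, Prod.mk.injEq]
  refine ⟨?_, ?_, ?_, ?_⟩
  · simp [-zsmul_eq_mul, cross, tb, trace_fin_three, mul_apply, Fin.sum_univ_three, adjugate_fin_three, det_fin_three]
    ring
  · simp [-zsmul_eq_mul, cross, tb, trace_fin_three, mul_apply, Fin.sum_univ_three, adjugate_fin_three, det_fin_three]
    ring
  all_goals
    ext i j
    fin_cases i <;> fin_cases j <;>
    simp [-zsmul_eq_mul, cross, tb, trace_fin_three, mul_apply, Fin.sum_univ_three, adjugate_fin_three, det_fin_three] <;>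
    ring

theorem phi_rank (t : ℤ) (x : MZ) (h : RankLeOne x) : RankLeOne (phi t x) := by
  rw [rank_iff] at h ⊢
  obtain ⟨a, b, A, B⟩ := x
  simp only [← Matrix.ext_iff, Fin.forall_fin_succ, phi] at h ⊢
  simp [mul_apply, Fin.sum_univ_three, adjugate_fin_three, one_apply] at h ⊢
  grind

end FreudenthalZ

namespace FreudenthalZ

structure Good (g : MZ → MZ) : Prop where
  inG : InG g
  T0 : ∀ x, Tcube x = 0 → Tcube (g x) = 0
  rk : ∀ x, RankLeOne (g x) → RankLeOne x

theorem Good.comp {g h : MZ → MZ} (hg : Good g) (hh : Good h) : Good (fun x => g (h x)) := by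
  obtain ⟨⟨l1, b1, q1, s1⟩, t1, r1⟩ := hg
  obtain ⟨⟨l2, b2, q2, s2⟩, t2, r2⟩ := hh
  refine ⟨⟨⟨fun x y => ?_, fun c x => ?_⟩, b1.comp b2, fun x => ?_, fun x y => ?_⟩,
    fun x hx => t1 _ (t2 _ hx), fun x hx => r2 _ (r1 _ hx)⟩
  · rw [l2.map_add, l1.map_add]
  · rw [l2.map_smul, l1.map_smul]
  · rw [q1, q2]
  · rw [s1, s2]

theorem Good.id : Good (fun x => x) :=
  ⟨⟨⟨fun _ _ => rfl, fun _ _ => rfl⟩, Function.bijective_id, fun _ => rfl, fun _ _ => rfl⟩,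
    fun _ h => h, fun _ h => h⟩

theorem phi_zero (t : ℤ) : phi t 0 = 0 := (phi_lin t).map_zero

theorem phi_good (t : ℤ) : Good (phi t) := by
  refine ⟨⟨phi_lin t, ?_, phi_q t, phi_symp t⟩, ?_, ?_⟩
  · refine Function.bijective_iff_has_inverse.2 ⟨phi (-t), fun x => ?_, fun x => phi_inv t x⟩
    have := phi_inv (-t) x
    rwa [neg_neg] at this
  · intro x hx
    rw [phi_T, hx, phi_zero]
  · intro x hx
    have h := phi_rank (-t) _ hx
    have := phi_inv (-t) x
    rw [neg_neg] at this
    rwa [this] at h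

theorem adj_neg (A : MatZ) : (-A).adjugate = A.adjugate := by
  ext i j
  fin_cases i <;> fin_cases j <;> simp [adjugate_fin_three]

theorem det_neg3 (A : MatZ) : (-A).det = -A.det := by
  simp [det_fin_three]; ring

theorem cross_neg (A B : MatZ) : cross (-A) B = - cross A B := by
  ext i j
  fin_cases i <;> fin_cases j <;> simp [cross, adjugate_fin_three] <;> ring

theorem sw_good : Good sw := by
  refine ⟨⟨⟨?_, ?_⟩, ?_, ?_, ?_⟩, ?_, ?_⟩
  · rintro ⟨a, b, A, B⟩ ⟨a', b', A', B'⟩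
    simp [sw, add_comm]
  · rintro c ⟨a, b, A, B⟩
    simp [sw]
  · refine Function.bijective_iff_has_inverse.2
      ⟨fun x => (x.2.1, -x.1, x.2.2.2, -x.2.2.1), fun x => ?_, fun x => ?_⟩ <;> simp [sw]
  · rintro ⟨a, b, A, B⟩
    simp only [sw, qz, adj_neg, det_neg3, tb]
    rw [trace_mul_comm, trace_mul_comm B.adjugate]
    simp
    ring
  · rintro ⟨a, b, A, B⟩ ⟨a', b', A', B'⟩
    simp only [sw, symp, tb, neg_mul, mul_neg, trace_neg]
    ring
  · rintro ⟨a, b, A, B⟩ h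
    simp only [Tcube, sw, adj_neg, det_neg3, cross_neg, Prod.mk_eq_zero] at h ⊢
    have e : tb (-B) A = - tb A B := by
      simp only [tb, neg_mul, trace_neg]; rw [trace_mul_comm]
    rw [e]
    obtain ⟨h1, h2, h3, h4⟩ := h
    refine ⟨by linarith, by linarith, ?_, ?_⟩
    · rw [← neg_eq_zero, ← h4]; module
    · rw [← h3]; module
  · rintro ⟨a, b, A, B⟩ h
    rw [rank_iff] at h ⊢
    simp only [sw, adj_neg] at h ⊢
    obtain ⟨h1, h2, h3, h4⟩ := h
    refine ⟨h2, ?_, ?_, ?_⟩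
    · rw [← h1]; module
    · rw [← neg_inj, ← mul_neg, h4]; module
    · rw [← neg_inj, ← neg_mul, h3]; module

theorem adjadj {P : MatZ} (hP : P.det = 1) : P.adjugate.adjugate = P := by
  rw [adjugate_adjugate _ (by simp)]; simp [hP]

theorem lev_rank {P Q : MatZ} (hP : P.det = 1) (hQ : Q.det = 1) (x : MZ) (h : RankLeOne x) :
    RankLeOne (lev P Q x) := by
  have p1 : P * P.adjugate = 1 := by rw [mul_adjugate, hP, one_smul]
  have q1 : Q * Q.adjugate = 1 := by rw [mul_adjugate, hQ, one_smul]
  have p2 : P.adjugate * P = 1 := by rw [adjugate_mul, hP, one_smul]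
  have q2 : Q.adjugate * Q = 1 := by rw [adjugate_mul, hQ, one_smul]
  rw [rank_iff] at h ⊢
  obtain ⟨a, b, A, B⟩ := x
  obtain ⟨h1, h2, h3, h4⟩ := h
  simp only [lev, adjugate_mul_distrib, adjadj hP, adjadj hQ] at *
  refine ⟨?_, ?_, ?_, ?_⟩
  · rw [← h1]; simp only [mul_smul_comm, smul_mul_assoc, mul_assoc]
  · rw [← h2]; simp only [mul_smul_comm, smul_mul_assoc, mul_assoc]
  · calc P * A * Q * (Q.adjugate * B * P.adjugate) = P * A * (Q * Q.adjugate) * B * P.adjugate := by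
          simp only [mul_assoc]
      _ = P * (A * B) * P.adjugate := by rw [q1]; simp only [mul_assoc, one_mul]
      _ = _ := by rw [h3, mul_smul_comm, mul_one, smul_mul_assoc, p1]
  · calc Q.adjugate * B * P.adjugate * (P * A * Q) = Q.adjugate * B * (P.adjugate * P) * A * Q := by
          simp only [mul_assoc]
      _ = Q.adjugate * (B * A) * Q := by rw [p2]; simp only [mul_assoc, one_mul]
      _ = _ := by rw [h4, mul_smul_comm, mul_one, smul_mul_assoc, q2]

theorem lev_inv {P Q : MatZ} (hP : P.det = 1) (hQ : Q.det = 1) (x : MZ) :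
    lev P.adjugate Q.adjugate (lev P Q x) = x := by
  have p2 : P.adjugate * P = 1 := by rw [adjugate_mul, hP, one_smul]
  have q2 : Q.adjugate * Q = 1 := by rw [adjugate_mul, hQ, one_smul]
  have p1 : P * P.adjugate = 1 := by rw [mul_adjugate, hP, one_smul]
  have q1 : Q * Q.adjugate = 1 := by rw [mul_adjugate, hQ, one_smul]
  obtain ⟨a, b, A, B⟩ := x
  simp only [lev, adjadj hP, adjadj hQ, Prod.mk.injEq, true_and]
  constructor
  · calc P.adjugate * (P * A * Q) * Q.adjugate = (P.adjugate * P) * A * (Q * Q.adjugate) := by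
          simp only [mul_assoc]
      _ = A := by rw [p2, q1, one_mul, mul_one]
  · calc Q * (Q.adjugate * B * P.adjugate) * P = (Q * Q.adjugate) * B * (P.adjugate * P) := by
          simp only [mul_assoc]
      _ = B := by rw [p2, q1, one_mul, mul_one]

theorem det_adj {P : MatZ} (hP : P.det = 1) : P.adjugate.det = 1 := by
  rw [det_adjugate, hP, one_pow]

theorem tb_lev {P Q : MatZ} (hP : P.det = 1) (hQ : Q.det = 1) (A B : MatZ) :
    tb (P * A * Q) (Q.adjugate * B * P.adjugate) = tb A B := by
  have p2 : P.adjugate * P = 1 := by rw [adjugate_mul, hP, one_smul]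
  have q1 : Q * Q.adjugate = 1 := by rw [mul_adjugate, hQ, one_smul]
  unfold tb
  calc (P * A * Q * (Q.adjugate * B * P.adjugate)).trace
      = (P * (A * (Q * Q.adjugate) * B * P.adjugate)).trace := by simp only [mul_assoc]
    _ = (A * B * (P.adjugate * P)).trace := by
        rw [q1, mul_one, trace_mul_comm]; simp only [mul_assoc]
    _ = _ := by rw [p2, mul_one]

theorem cross_lev (P Q A B : MatZ) : cross (P * A * Q) (P * B * Q) =
    Q.adjugate * cross A B * P.adjugate := by
  unfold cross
  rw [← add_mul, ← mul_add]
  simp only [adjugate_mul_distrib, mul_sub, sub_mul, mul_assoc]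

theorem lev_good {P Q : MatZ} (hP : P.det = 1) (hQ : Q.det = 1) : Good (lev P Q) := by
  refine ⟨⟨⟨?_, ?_⟩, ?_, ?_, ?_⟩, ?_, ?_⟩
  · rintro ⟨a, b, A, B⟩ ⟨a', b', A', B'⟩
    simp [lev, mul_add, add_mul]
  · rintro c ⟨a, b, A, B⟩
    simp only [lev, Prod.smul_mk, mul_smul_comm, smul_mul_assoc]
  · refine Function.bijective_iff_has_inverse.2
      ⟨lev P.adjugate Q.adjugate, fun x => lev_inv hP hQ x, fun x => ?_⟩
    have := lev_inv (det_adj hP) (det_adj hQ) x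
    rwa [adjadj hP, adjadj hQ] at this
  · rintro ⟨a, b, A, B⟩
    simp only [lev, qz, tb_lev hP hQ, det_mul, hP, hQ, det_adj hP, det_adj hQ,
      adjugate_mul_distrib, adjadj hP, adjadj hQ]
    have := tb_lev (det_adj hQ) (det_adj hP) A.adjugate B.adjugate
    rw [adjadj hP, adjadj hQ] at this
    simp only [mul_assoc] at this ⊢
    rw [this]; ring
  · rintro ⟨a, b, A, B⟩ ⟨a', b', A', B'⟩
    have h1 := tb_lev hP hQ A B'
    have h2 := tb_lev hP hQ A' B
    unfold tb at h2
    rw [trace_mul_comm, trace_mul_comm A'] at h2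
    change tb _ _ = tb _ _ at h2
    simp only [lev, symp, h1, h2]
  · rintro ⟨a, b, A, B⟩ h
    have c1 := cross_lev P Q A B.adjugate
    have c2 := cross_lev Q.adjugate P.adjugate B A.adjugate
    rw [adjadj hP, adjadj hQ] at c2
    simp only [Tcube, Prod.mk_eq_zero] at h
    obtain ⟨h1, h2, h3, h4⟩ := h
    simp only [lev, Tcube, tb_lev hP hQ, det_mul, hP, hQ, det_adj hP, det_adj hQ,
      adjugate_mul_distrib, adjadj hP, adjadj hQ, Prod.mk_eq_zero]
    simp only [← mul_assoc] at c1 c2 ⊢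
    rw [c1, c2]
    refine ⟨by linarith, by linarith, ?_, ?_⟩
    · have := congrArg (fun X => P * X * Q) h3
      simp only [mul_sub, sub_mul, mul_zero, zero_mul, mul_smul_comm, smul_mul_assoc] at this
      exact this
    · have := congrArg (fun X => Q.adjugate * X * P.adjugate) h4
      simp only [mul_add, add_mul, mul_neg, neg_mul, mul_zero, zero_mul, mul_smul_comm,
        smul_mul_assoc] at this
      exact this
  · intro x hx
    have := lev_rank (det_adj hP) (det_adj hQ) _ hx
    rwa [lev_inv hP hQ] at this

end FreudenthalZ

namespace FreudenthalZ

/-- Conjugate of `phi` by the swap. -/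
def psi (t : ℤ) (x : MZ) : MZ := sw (sw (sw (phi t (sw x))))

theorem psi_good (t : ℤ) : Good (psi t) :=
  sw_good.comp (sw_good.comp (sw_good.comp ((phi_good t).comp sw_good)))

theorem psi_fst (t : ℤ) (x : MZ) : (psi t x).1 = x.1 := by
  simp [psi, sw, phi]

theorem psi_B (t : ℤ) (x : MZ) :
    (psi t x).2.2.2 = x.2.2.2 - x.1 • single 0 0 t := by
  obtain ⟨a, b, A, B⟩ := x
  ext i j
  fin_cases i <;> fin_cases j <;> simp [psi, sw, phi, -zsmul_eq_mul] <;> ring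

def cyc : Fin 3 → MatZ
  | 0 => 1
  | 1 => !![0, 1, 0; 0, 0, 1; 1, 0, 0]
  | 2 => !![0, 0, 1; 1, 0, 0; 0, 1, 0]

theorem cyc_det (i : Fin 3) : (cyc i).det = 1 := by
  fin_cases i <;> simp [cyc, det_fin_three]

theorem cyc_adj (i : Fin 3) : (cyc i).adjugate = (cyc i)ᵀ := by
  fin_cases i
  · simp [cyc]
  all_goals
    ext a b
    fin_cases a <;> fin_cases b <;> simp [cyc, adjugate_fin_three]

theorem cyc_entry (i j : Fin 3) (A : MatZ) : (cyc i * A * (cyc j)ᵀ) 0 0 = A i j := by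
  fin_cases i <;> fin_cases j <;>
    simp [cyc, mul_apply, Fin.sum_univ_three, vecMul, vecHead, vecTail, one_apply]

theorem cyc_single (i j : Fin 3) (t : ℤ) :
    (cyc i)ᵀ * single 0 0 t * cyc j = single i j t := by
  ext a b
  fin_cases i <;> fin_cases j <;> fin_cases a <;> fin_cases b <;>
    simp [cyc, mul_apply, Fin.sum_univ_three, single_apply, one_apply]

theorem cyc_mul (i : Fin 3) : (cyc i)ᵀ * cyc i = 1 := by
  rw [← cyc_adj, adjugate_mul, cyc_det, one_smul]

theorem cyc_detT (i : Fin 3) : ((cyc i)ᵀ).det = 1 := by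
  rw [det_transpose, cyc_det]

theorem cyc_adjT (i : Fin 3) : ((cyc i)ᵀ).adjugate = cyc i := by
  rw [← cyc_adj, adjadj (cyc_det i)]

theorem moveB (i j : Fin 3) : ∃ g, Good g ∧ ∀ x : MZ, (g x).1 = x.1 ∧
    (g x).2.2.2 0 0 = x.2.2.2 i j := by
  refine ⟨_, lev_good (cyc_det j) (cyc_detT i), fun x => ⟨rfl, ?_⟩⟩
  simp only [lev, cyc_adjT, cyc_adj]
  exact cyc_entry i j _

theorem psi_single (i j : Fin 3) (t : ℤ) : ∃ g, Good g ∧ ∀ x : MZ, (g x).1 = x.1 ∧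
    (g x).2.2.2 = x.2.2.2 - x.1 • single i j t := by
  refine ⟨_, (lev_good (cyc_detT j) (cyc_det i)).comp ((psi_good t).comp
    (lev_good (cyc_det j) (cyc_detT i))), fun x => ⟨?_, ?_⟩⟩
  · simp [lev, psi_fst]
  · simp only [lev, psi_B, cyc_adjT, cyc_adj]
    rw [mul_sub, sub_mul, mul_smul_comm, smul_mul_assoc, cyc_single]
    congr 1
    calc (cyc i)ᵀ * (cyc i * x.2.2.2 * (cyc j)ᵀ) * cyc j
        = ((cyc i)ᵀ * cyc i) * x.2.2.2 * ((cyc j)ᵀ * cyc j) := by simp only [mul_assoc]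
      _ = _ := by rw [cyc_mul, cyc_mul, one_mul, mul_one]

theorem psi_gen (C : MatZ) : ∃ g, Good g ∧ ∀ x : MZ, (g x).1 = x.1 ∧
    (g x).2.2.2 = x.2.2.2 - x.1 • C := by
  induction C using Matrix.induction_on' with
  | h_zero => exact ⟨_, Good.id, fun x => ⟨rfl, by simp⟩⟩
  | h_add p q hp hq =>
    obtain ⟨g, hg, h⟩ := hp
    obtain ⟨g', hg', h'⟩ := hq
    refine ⟨_, hg.comp hg', fun x => ⟨?_, ?_⟩⟩
    · rw [(h _).1, (h' _).1]
    · rw [(h _).2, (h' _).1, (h' _).2, smul_add]; abel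
  | h_std_basis i j t => exact psi_single i j t

/-- Minimality of the first coordinate in the orbit. -/
def Mini (y : MZ) : Prop := 0 < y.1 ∧ ∀ g, Good g → 0 < (g y).1 → y.1 ≤ (g y).1

theorem Mini.map {y : MZ} (h : Mini y) {g : MZ → MZ} (hg : Good g) (e : (g y).1 = y.1) :
    Mini (g y) := by
  refine ⟨e ▸ h.1, fun g' hg' hp => ?_⟩
  rw [e]
  exact h.2 _ (hg'.comp hg) hp

theorem Mini.dvdB0 {y : MZ} (h : Mini y) : y.1 ∣ y.2.2.2 0 0 := by
  by_contra hn
  have h1 : 0 < y.2.2.2 0 0 % y.1 :=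
    lt_of_le_of_ne (Int.emod_nonneg _ h.1.ne') fun e => hn (Int.dvd_of_emod_eq_zero e.symm)
  have h2 := Int.emod_lt_of_pos (y.2.2.2 0 0) h.1
  have h3 := h.2 _ ((phi_good (-1)).comp (psi_good (y.2.2.2 0 0 / y.1)))
  have e : (phi (-1) (psi (y.2.2.2 0 0 / y.1) y)).1 = y.1 - y.2.2.2 0 0 % y.1 := by
    simp only [phi, psi_fst, psi_B]
    simp [-zsmul_eq_mul]
    rw [Int.emod_def]
    ring
  rw [e] at h3
  have := h3 (by omega)
  omega

theorem Mini.dvdB {y : MZ} (h : Mini y) (i j : Fin 3) : y.1 ∣ y.2.2.2 i j := by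
  obtain ⟨g, hg, hh⟩ := moveB i j
  have := (h.map hg (hh y).1).dvdB0
  rwa [(hh y).1, (hh y).2] at this

theorem Mini.clearB {y : MZ} (h : Mini y) : ∃ g, Good g ∧ (g y).1 = y.1 ∧ (g y).2.2.2 = 0 := by
  choose C hC using h.dvdB
  obtain ⟨g, hg, hh⟩ := psi_gen (of C)
  refine ⟨g, hg, (hh y).1, ?_⟩
  rw [(hh y).2]
  ext i j
  simp [-zsmul_eq_mul, hC i j]

theorem Mini.dvdA11 {y : MZ} (h : Mini y) (hB : y.2.2.2 = 0) (i j : Fin 3) :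
    y.1 ∣ y.2.2.1 i j := by
  have key : ∀ z : MZ, Mini z → z.2.2.2 = 0 → z.1 ∣ z.2.2.1 1 1 := by
    intro z hz hB
    have e : (phi 1 z).1 = z.1 := by simp [phi, hB]
    have := (hz.map (phi_good 1) e).dvdB 2 2
    rw [e] at this
    simpa [phi, hB] using this
  -- move entry (i,j) to (1,1)
  have : ∃ P Q : MatZ, P.det = 1 ∧ Q.det = 1 ∧ ∀ A : MatZ, (P * A * Q) 1 1 = A i j := by
    refine ⟨cyc 2 * cyc i, (cyc 2 * cyc j)ᵀ, by simp [cyc_det], by simp [cyc_det], fun A => ?_⟩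
    have e : cyc 2 * cyc i * A * (cyc 2 * cyc j)ᵀ = cyc 2 * (cyc i * A * (cyc j)ᵀ) * (cyc 2)ᵀ := by
      simp only [mul_assoc, transpose_mul]
    rw [e, ← cyc_entry i j A]
    generalize cyc i * A * (cyc j)ᵀ = N
    simp [cyc, Matrix.mul_apply, Fin.sum_univ_three, vecMul, dotProduct]
  obtain ⟨P, Q, hP, hQ, hPQ⟩ := this
  have := key (lev P Q y) (h.map (lev_good hP hQ) rfl) (by simp [lev, hB])
  simpa [lev, hPQ] using this

theorem exists_mini (x : MZ) (hx : x ≠ 0) : ∃ g, Good g ∧ Mini (g x) := by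
  have h0 : ∃ g, Good g ∧ (g x).1 ≠ 0 := by
    by_contra hn
    push Not at hn
    have hB : ∀ g, Good g → ∀ i j, (g x).2.2.2 i j = 0 := by
      intro g hg i j
      obtain ⟨g', hg', hh⟩ := moveB i j
      have h1 := hn _ ((phi_good 1).comp (hg'.comp hg))
      have h2 := hn _ (hg'.comp hg)
      simp only [phi, (hh _).1, (hh _).2] at h1 h2
      rw [h2] at h1
      simpa using h1
    apply hx
    have a1 := hn _ Good.id
    have a2 := hn _ sw_good
    have a3 := hB _ Good.id
    have a4 := hB _ sw_good
    obtain ⟨a, b, A, B⟩ := x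
    simp only [sw] at a1 a2 a3 a4
    simp only [Prod.mk_eq_zero]
    exact ⟨a1, by simpa using a2, by ext i j; exact a4 i j, by ext i j; exact a3 i j⟩
  have h1 : ∃ g, Good g ∧ 0 < (g x).1 := by
    obtain ⟨g, hg, h⟩ := h0
    rcases lt_or_gt_of_ne h with h | h
    · exact ⟨_, sw_good.comp (sw_good.comp hg), by simpa [sw] using h⟩
    · exact ⟨g, hg, h⟩
  have h2 : ∃ n : ℕ, ∃ g, Good g ∧ 0 < (g x).1 ∧ (g x).1.toNat = n := by
    obtain ⟨g, hg, h⟩ := h1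
    exact ⟨_, g, hg, h, rfl⟩
  classical
  obtain ⟨g, hg, hp, hn⟩ := Nat.find_spec h2
  refine ⟨g, hg, hp, fun g' hg' hp' => ?_⟩
  have := Nat.find_min' h2 ⟨_, hg'.comp hg, hp', rfl⟩
  omega

theorem bez (a b : ℤ) : ∃ p q r s : ℤ, p * s - q * r = 1 ∧ r * a + s * b = 0 := by
  by_cases h : Int.gcd a b = 0
  · rw [Int.gcd_eq_zero_iff] at h
    exact ⟨1, 0, 0, 1, by simp, by simp [h.1, h.2]⟩
  · have hg : (Int.gcd a b : ℤ) ≠ 0 := by exact_mod_cast h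
    obtain ⟨a', ha⟩ := Int.gcd_dvd_left a b
    obtain ⟨b', hb⟩ := Int.gcd_dvd_right a b
    have hab := Int.gcd_eq_gcd_ab a b
    refine ⟨Int.gcdA a b, Int.gcdB a b, -b', a', ?_, ?_⟩
    · apply mul_left_cancel₀ hg
      linear_combination (-Int.gcdA a b) * ha - Int.gcdB a b * hb - hab
    · linear_combination (-b') * ha + a' * hb

theorem clear_vec (v : Fin 3 → ℤ) : ∃ P : MatZ, P.det = 1 ∧ (P *ᵥ v) 1 = 0 ∧ (P *ᵥ v) 2 = 0 := by
  obtain ⟨p, q, r, s, h1, h2⟩ := bez (v 1) (v 2)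
  obtain ⟨p', q', r', s', h1', h2'⟩ := bez (v 0) (p * v 1 + q * v 2)
  refine ⟨!![p', q', 0; r', s', 0; 0, 0, 1] * !![1, 0, 0; 0, p, q; 0, r, s], ?_, ?_, ?_⟩
  · rw [det_mul]; simp [det_fin_three]; rw [h1', h1, one_mul]
  · rw [← mulVec_mulVec]
    simp [mulVec, dotProduct, Fin.sum_univ_three]
    linarith
  · rw [← mulVec_mulVec]
    simp [mulVec, dotProduct, Fin.sum_univ_three]
    linarith

theorem smith1 (A : MatZ) (hA : A.adjugate = 0) (h0 : A ≠ 0) : ∃ P Q : MatZ, P.det = 1 ∧ Q.det = 1 ∧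
    ∃ m : ℤ, 0 < m ∧ P * A * Q = Matrix.diagonal ![m, 0, 0] := by
  have hj : ∃ i j, A i j ≠ 0 := by
    by_contra hn
    push Not at hn
    exact h0 (by ext i j; exact hn i j)
  obtain ⟨i0, j0, hj⟩ := hj
  -- move the column to be column 0
  obtain ⟨P, hP, h1, h2⟩ := clear_vec (fun i => (A * (cyc j0)ᵀ) i 0)
  have hPv : ∀ i, (P *ᵥ (fun i => (A * (cyc j0)ᵀ) i 0)) i = (P * (A * (cyc j0)ᵀ)) i 0 := by
    intro i; rw [Matrix.mul_apply]; rfl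
  rw [hPv] at h1 h2
  set M := P * (A * (cyc j0)ᵀ) with hM
  have hMadj : M.adjugate = 0 := by
    rw [hM, adjugate_mul_distrib, adjugate_mul_distrib, hA]; simp
  have pinv : P.adjugate * P = 1 := by rw [adjugate_mul, hP, one_smul]
  have hM0 : M 0 0 ≠ 0 := by
    intro hz
    have e : P.adjugate * M = A * (cyc j0)ᵀ := by
      rw [hM, ← mul_assoc, pinv, one_mul]
    have e2 : (A * (cyc j0)ᵀ) i0 0 = 0 := by
      rw [← e, mul_apply, Fin.sum_univ_three, hz, h1, h2]; simp
    apply hj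
    rw [← e2]
    fin_cases j0 <;> simp [cyc, mul_apply, Fin.sum_univ_three, one_apply]
  have hr : ∀ j, M 1 j = 0 ∧ M 2 j = 0 := by
    have hh := hMadj
    rw [adjugate_fin_three] at hh
    simp only [← Matrix.ext_iff, Fin.forall_fin_succ] at hh
    simp [h1, h2, hM0] at hh
    intro j
    fin_cases j <;> simp [h1, h2] <;> tauto
  obtain ⟨R, hR, r1, r2⟩ := clear_vec (fun j => M 0 j)
  have hMR : M * Rᵀ = Matrix.diagonal ![(M * Rᵀ) 0 0, 0, 0] := by
    have r1' : (M * Rᵀ) 0 1 = 0 := by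
      rw [← r1]; simp [mulVec, dotProduct, mul_apply, Fin.sum_univ_three]; ring
    have r2' : (M * Rᵀ) 0 2 = 0 := by
      rw [← r2]; simp [mulVec, dotProduct, mul_apply, Fin.sum_univ_three]; ring
    have r3 : ∀ j, (M * Rᵀ) 1 j = 0 := fun j => by simp [mul_apply, (hr _).1]
    have r4 : ∀ j, (M * Rᵀ) 2 j = 0 := fun j => by simp [mul_apply, (hr _).2]
    generalize M * Rᵀ = N at *
    ext i j
    fin_cases i <;> fin_cases j <;> simp [r1', r2', r3, r4]
  set m := (M * Rᵀ) 0 0 with hm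
  have hRd : Rᵀ.det = 1 := by rw [det_transpose, hR]
  have rinv : Rᵀ * Rᵀ.adjugate = 1 := by rw [mul_adjugate, hRd, one_smul]
  have hm0 : m ≠ 0 := by
    intro hz
    rw [hz] at hMR
    have e : M = 0 := by
      calc M = M * Rᵀ * Rᵀ.adjugate := by rw [mul_assoc, rinv, mul_one]
        _ = 0 := by
          rw [hMR]; ext i j; fin_cases i <;> simp
    exact hM0 (by rw [e]; rfl)
  have hQ : ((cyc j0)ᵀ * Rᵀ).det = 1 := by rw [det_mul, cyc_detT, hRd, one_mul]
  have hPAQ : P * A * ((cyc j0)ᵀ * Rᵀ) = Matrix.diagonal ![m, 0, 0] := by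
    rw [← hMR, hM]; simp only [mul_assoc]
  rcases lt_or_gt_of_ne hm0 with hneg | hpos
  · refine ⟨Matrix.diagonal ![-1, -1, 1] * P, _, ?_, hQ, -m, by omega, ?_⟩
    · rw [det_mul, hP, det_diagonal, Fin.prod_univ_three]; simp
    · rw [mul_assoc, mul_assoc, ← mul_assoc P, hPAQ, diagonal_mul_diagonal]
      congr 1
      ext i; fin_cases i <;> simp
  · exact ⟨P, _, hP, hQ, m, hpos, hPAQ⟩

theorem dvd_gcd20 (d : ℤ) (x : MZ) : d ∣ gcd20 x ↔ ∃ y : MZ, x = d • y := by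
  obtain ⟨a, b, A, B⟩ := x
  simp only [gcd20, dvd_gcd_iff, Finset.dvd_gcd_iff, Finset.mem_univ, true_imp_iff, Prod.forall]
  constructor
  · rintro ⟨⟨a', rfl⟩, ⟨b', rfl⟩, hA, hB⟩
    choose A' hA using hA
    choose B' hB using hB
    refine ⟨(a', b', of A', of B'), ?_⟩
    simp only [Prod.smul_mk, Prod.mk.injEq, smul_eq_mul, true_and]
    constructor
    · ext i j; simp [-zsmul_eq_mul, hA]
    · ext i j; simp [-zsmul_eq_mul, hB]
  · rintro ⟨⟨a', b', A', B'⟩, h⟩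
    simp only [Prod.smul_mk, Prod.mk.injEq] at h
    obtain ⟨rfl, rfl, rfl, rfl⟩ := h
    exact ⟨⟨a', by simp⟩, ⟨b', by simp⟩, fun i j => ⟨A' i j, by simp [-zsmul_eq_mul]⟩,
      fun i j => ⟨B' i j, by simp [-zsmul_eq_mul]⟩⟩

theorem gcd20_nonneg (x : MZ) : 0 ≤ gcd20 x := by
  unfold gcd20
  exact Int.nonneg_of_normalize_eq_self (normalize_gcd _ _)

theorem gcd20_map {g : MZ → MZ} (hg : InG g) (x : MZ) : gcd20 (g x) = gcd20 x := by
  obtain ⟨l, b, -, -⟩ := hg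
  apply Int.dvd_antisymm (gcd20_nonneg _) (gcd20_nonneg _)
  · rw [dvd_gcd20]
    obtain ⟨y, hy⟩ := (dvd_gcd20 _ (g x)).1 dvd_rfl
    obtain ⟨z, rfl⟩ := b.2 y
    rw [← l.map_smul] at hy
    exact ⟨z, b.1 hy⟩
  · rw [dvd_gcd20]
    obtain ⟨y, hy⟩ := (dvd_gcd20 _ x).1 dvd_rfl
    exact ⟨g y, by rw [← l.map_smul, ← hy]⟩

theorem gcd20_normal {k m : ℤ} (hk : 0 < k) (h : k ∣ m) :
    gcd20 ((k, 0, Matrix.diagonal ![m, 0, 0], 0) : MZ) = k := by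
  apply Int.dvd_antisymm (gcd20_nonneg _) hk.le
  · exact gcd_dvd_left _ _
  · rw [dvd_gcd20]
    obtain ⟨n, rfl⟩ := h
    refine ⟨(1, 0, Matrix.diagonal ![n, 0, 0], 0), ?_⟩
    simp only [Prod.smul_mk, Prod.mk.injEq, smul_eq_mul, mul_one, mul_zero, smul_zero, true_and,
      and_true]
    ext i j
    fin_cases i <;> fin_cases j <;> simp [-zsmul_eq_mul]

theorem part1 (x : MZ) (hT : Tcube x = 0) (hr : ¬ RankLeOne x) :
      ∃ (g : MZ → MZ) (m : ℤ), InG g ∧ 0 < gcd20 x ∧ 0 < m ∧ gcd20 x ∣ m ∧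
        g x = (gcd20 x, 0, Matrix.diagonal ![m, 0, 0], 0) := by
  have hx : x ≠ 0 := by
    rintro rfl
    apply hr
    rw [rank_iff]
    simp
  obtain ⟨g, hg, hmin⟩ := exists_mini x hx
  obtain ⟨g', hg', e1, e2⟩ := hmin.clearB
  have hmin' := hmin.map hg' e1
  have hdiv := hmin'.dvdA11 e2
  have hT' := hg'.T0 _ (hg.T0 _ hT)
  have hr' : ¬ RankLeOne (g' (g x)) := fun h => hr (hg.rk _ (hg'.rk _ h))
  have hG := hg'.comp hg
  have hpos := hmin'.1
  clear e1
  rcases hy : g' (g x) with ⟨a, b, A, B⟩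
  rw [hy] at hT' hr' hpos hdiv e2
  simp only at hdiv hpos e2
  subst e2
  simp only [Tcube, Prod.mk_eq_zero] at hT'
  obtain ⟨t1, t2, t3, t4⟩ := hT'
  have hb : b = 0 := by
    have : a ^ 2 * b = 0 := by simpa [tb] using t1
    rcases mul_eq_zero.1 this with h | h
    · exact absurd (pow_eq_zero_iff (by norm_num) |>.1 h) hpos.ne'
    · exact h
  subst hb
  have hadj : A.adjugate = 0 := by
    have : (2 * a) • A.adjugate = 0 := by
      simpa [tb, cross, -zsmul_eq_mul] using t4
    rcases smul_eq_zero.1 this with h | h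
    · omega
    · exact h
  have hA0 : A ≠ 0 := by
    rintro rfl
    apply hr'
    rw [rank_iff]
    simp
  obtain ⟨P, Q, hP, hQ, m, hm, hPQ⟩ := smith1 A hadj hA0
  have hk : a ∣ m := by
    have : m = (P * A * Q) 0 0 := by rw [hPQ]; simp
    rw [this]
    simp only [mul_apply]
    exact Finset.dvd_sum fun i _ => Dvd.dvd.mul_right
      (Finset.dvd_sum fun j _ => Dvd.dvd.mul_left (hdiv _ _) _) _
  have hfin : lev P Q (g' (g x)) = (a, 0, Matrix.diagonal ![m, 0, 0], 0) := by
    rw [hy]; simp [lev, hPQ]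
  have hGG := (lev_good hP hQ).comp hG
  have hgcd : gcd20 x = a := by
    rw [← gcd20_map hGG.inG x, hfin, gcd20_normal hpos hk]
  rw [hgcd]
  exact ⟨_, m, hGG.inG, hpos, hm, hk, hfin⟩

/-- Second-order part of the quartic norm (times two), by finite differences. -/
def Q2 (x y : MZ) : ℤ := qz (x + y) + qz (x - y) - 2 * qz x - 2 * qz y

def Bil (x y z : MZ) : ℤ := Q2 x (y + z) - Q2 x y - Q2 x z

theorem Bil_map {g : MZ → MZ} (hg : InG g) (x y z : MZ) : Bil (g x) (g y) (g z) = Bil x y z := by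
  obtain ⟨l, -, q, -⟩ := hg
  simp only [Bil, Q2, ← l.map_add, ← l.map_sub, q]

theorem Q2_normal (k m : ℤ) (y : MZ) : Q2 (k, 0, Matrix.diagonal ![m, 0, 0], 0) y =
    2 * ((m * y.2.2.2 0 0 - k * y.2.1) ^ 2 + 4 * k * m *
      (y.2.2.1 1 1 * y.2.2.1 2 2 - y.2.2.1 1 2 * y.2.2.1 2 1)) := by
  obtain ⟨a, b, A, B⟩ := y
  simp [Q2, qz, tb, trace_fin_three, mul_apply, Fin.sum_univ_three, adjugate_fin_three,
    det_fin_three, Fin.prod_univ_three]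
  ring

theorem Bil_normal (k m : ℤ) (y z : MZ) : Bil (k, 0, Matrix.diagonal ![m, 0, 0], 0) y z =
    4 * (m * y.2.2.2 0 0 - k * y.2.1) * (m * z.2.2.2 0 0 - k * z.2.1) + 8 * k * m *
      (y.2.2.1 1 1 * z.2.2.1 2 2 + z.2.2.1 1 1 * y.2.2.1 2 2
        - y.2.2.1 1 2 * z.2.2.1 2 1 - z.2.2.1 1 2 * y.2.2.1 2 1) := by
  simp only [Bil, Q2_normal]
  simp
  ring

theorem minor_dvd (k m : ℤ) (h : k ∣ m) (y z y' z' : MZ) :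
    32 * k ^ 3 * m ∣ Bil (k, 0, Matrix.diagonal ![m, 0, 0], 0) y z *
      Bil (k, 0, Matrix.diagonal ![m, 0, 0], 0) y' z' -
      Bil (k, 0, Matrix.diagonal ![m, 0, 0], 0) y z' *
      Bil (k, 0, Matrix.diagonal ![m, 0, 0], 0) y' z := by
  obtain ⟨n, rfl⟩ := h
  have hB : ∀ y z, ∃ h : ℤ, Bil (k, 0, Matrix.diagonal ![k * n, 0, 0], 0) y z =
      4 * k ^ 2 * ((n * y.2.2.2 0 0 - y.2.1) * (n * z.2.2.2 0 0 - z.2.1)) + 8 * k ^ 2 * n * h := by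
    intro y z
    rw [Bil_normal]
    exact ⟨y.2.2.1 1 1 * z.2.2.1 2 2 + z.2.2.1 1 1 * y.2.2.1 2 2
        - y.2.2.1 1 2 * z.2.2.1 2 1 - z.2.2.1 1 2 * y.2.2.1 2 1, by ring⟩
  choose f hf using hB
  simp only [hf]
  refine ⟨(n * y.2.2.2 0 0 - y.2.1) * (n * z.2.2.2 0 0 - z.2.1) * f y' z'
    + (n * y'.2.2.2 0 0 - y'.2.1) * (n * z'.2.2.2 0 0 - z'.2.1) * f y z
    - (n * y.2.2.2 0 0 - y.2.1) * (n * z'.2.2.2 0 0 - z'.2.1) * f y' z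
    - (n * y'.2.2.2 0 0 - y'.2.1) * (n * z.2.2.2 0 0 - z.2.1) * f y z'
    + 2 * n * (f y z * f y' z' - f y z' * f y' z), ?_⟩
  ring

theorem minor_val (k m : ℤ) : ∃ y z y' z' : MZ,
    32 * k ^ 3 * m = Bil (k, 0, Matrix.diagonal ![m, 0, 0], 0) y z *
      Bil (k, 0, Matrix.diagonal ![m, 0, 0], 0) y' z' -
      Bil (k, 0, Matrix.diagonal ![m, 0, 0], 0) y z' *
      Bil (k, 0, Matrix.diagonal ![m, 0, 0], 0) y' z := by
  refine ⟨(0, 1, 0, 0), (0, 1, 0, 0), (0, 0, Matrix.diagonal ![0, 1, 0], 0),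
    (0, 0, Matrix.diagonal ![0, 0, 1], 0), ?_⟩
  simp only [Bil_normal]
  simp
  ring

theorem part2 (k m k' m' : ℤ) (hk : 0 < k) (hm : 0 < m) (h : k ∣ m) (hk' : 0 < k') (hm' : 0 < m')
    (h' : k' ∣ m') (hg : ∃ g : MZ → MZ, InG g ∧
        g ((k, 0, Matrix.diagonal ![m, 0, 0], 0) : MZ)
          = (k', 0, Matrix.diagonal ![m', 0, 0], 0)) : k = k' ∧ m = m' := by
  obtain ⟨g, hg, e⟩ := hg
  have hkk : k = k' := by
    rw [← gcd20_normal hk h, ← gcd20_normal hk' h', ← e, gcd20_map hg]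
  subst hkk
  refine ⟨rfl, ?_⟩
  have d1 : 32 * k ^ 3 * m ∣ 32 * k ^ 3 * m' := by
    obtain ⟨y, z, y', z', hv⟩ := minor_val k m'
    rw [hv, ← e]
    obtain ⟨y, rfl⟩ := hg.2.1.2 y
    obtain ⟨z, rfl⟩ := hg.2.1.2 z
    obtain ⟨y', rfl⟩ := hg.2.1.2 y'
    obtain ⟨z', rfl⟩ := hg.2.1.2 z'
    simp only [Bil_map hg]
    exact minor_dvd k m h _ _ _ _
  have d2 : 32 * k ^ 3 * m' ∣ 32 * k ^ 3 * m := by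
    obtain ⟨y, z, y', z', hv⟩ := minor_val k m
    rw [hv]
    rw [← Bil_map hg _ y z, ← Bil_map hg _ y' z', ← Bil_map hg _ y z', ← Bil_map hg _ y' z, e]
    exact minor_dvd k m' h' _ _ _ _
  have hc : (32 * k ^ 3) ≠ 0 := by positivity
  exact Int.dvd_antisymm hm.le hm'.le ((mul_dvd_mul_iff_left hc).1 d1)
    ((mul_dvd_mul_iff_left hc).1 d2)

end FreudenthalZ

/-- **Orbits of rank-2 elements of `M_ℤ`**: every `x` of rank 2 (`T(x,x,x) = 0` but the
rank `≤ 1` condition fails) can be brought by `G_ℤ` to `(k, 0, diag(m,0,0), 0)` with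
`k ∣ m`, `k, m > 0`, where `k = gcd` of the 20 coordinates of `x`; moreover distinct
such normal forms lie in distinct orbits. -/
theorem rank_two_orbits_Z :
    (∀ x : MZ, Tcube x = 0 → ¬ RankLeOne x →
      ∃ (g : MZ → MZ) (m : ℤ), InG g ∧ 0 < gcd20 x ∧ 0 < m ∧ gcd20 x ∣ m ∧
        g x = (gcd20 x, 0, Matrix.diagonal ![m, 0, 0], 0)) ∧
    (∀ k m k' m' : ℤ, 0 < k → 0 < m → k ∣ m → 0 < k' → 0 < m' → k' ∣ m' →
      (∃ g : MZ → MZ, InG g ∧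
        g ((k, 0, Matrix.diagonal ![m, 0, 0], 0) : MZ)
          = (k', 0, Matrix.diagonal ![m', 0, 0], 0)) →
      k = k' ∧ m = m') := by
  exact ⟨part1, part2⟩
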